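/- Let γ : (−ε, ε) → 𝒢_{O₀} be a curve with γ(0) = U = ∑_{n=1}^d e^{iθ_n}|e_{σ(n)}⟩⟨e_n| (for some permutation σ and reals θ_n), and suppose there is an operator Q on H such that for every vector h ∈ H, (γ(t)h − U h)/t → Q h as t → 0. Then there exist complex numbers α_1, …, α_d such that Q = ∑_{n=1}^d α_n |e_{σ(n)}⟩⟨e_n| (with the same permutation σ). In particular, every tangent vector of 𝒢_{O₀} at the identity has the form ∑_n α_n |e_n⟩⟨e_n|. -/

import Mathlib

/- STATEMENT 6: A tangent vector Q at U = ∑ e^{iθ_n}|e_{σ(n)}⟩⟨e_n| of the structure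
group 𝒢_{O₀} has the form Q = ∑ α_n |e_{σ(n)}⟩⟨e_n| (same permutation σ). -/

noncomputable section

open scoped InnerProductSpace

abbrev E (d : ℕ) : Type := EuclideanSpace ℂ (Fin d)
abbrev Op (d : ℕ) : Type := E d →L[ℂ] E d

/-- The rank-one operator `|x⟩⟨y| : h ↦ ⟨y, h⟩ x`. -/
def rankOne {d : ℕ} (x y : E d) : Op d :=
  (ContinuousLinearMap.toSpanSingleton ℂ x).comp (innerSL ℂ y)

/-- The standard orthonormal basis vector `e_n` of `ℂ^d`. -/
def stdVec (d : ℕ) (n : Fin d) : E d := EuclideanSpace.single n 1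

/-- Membership in the structure group `𝒢_{O₀}`:
`U = ∑_n e^{iθ_n}|e_{σ(n)}⟩⟨e_n|` for some permutation `σ` and phases `θ`. -/
def memG {d : ℕ} (U : Op d) : Prop :=
  ∃ (σ : Equiv.Perm (Fin d)) (θ : Fin d → ℝ),
    U = ∑ n, Complex.exp (θ n * Complex.I) • rankOne (stdVec d (σ n)) (stdVec d n)

/-- A weighted permutation operator sends `e_k` to the `k`-th weight times `e_{σ k}`. -/
lemma sum_smul_rankOne_stdVec_apply {d : ℕ} (σ : Equiv.Perm (Fin d)) (c : Fin d → ℂ)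
    (k : Fin d) :
    (∑ n, c n • rankOne (stdVec d (σ n)) (stdVec d n)) (stdVec d k)
      = c k • stdVec d (σ k) := by
  rw [sum_apply, Finset.sum_eq_single k]
  · simp [rankOne, stdVec]
  · intro n _ hn
    simp [rankOne, stdVec, EuclideanSpace.inner_single_left, hn]
  · simp

/-- The matrix entries of an element of the structure group either vanish or have modulus one. -/
lemma memG.entry_eq_zero_or_norm_eq_one {d : ℕ} {U : Op d} (hU : memG U) (k m : Fin d) :
    U (stdVec d k) m = 0 ∨ ‖U (stdVec d k) m‖ = 1 := by
  obtain ⟨τ, φ, rfl⟩ := hU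
  rw [sum_smul_rankOne_stdVec_apply τ (fun n => Complex.exp (φ n * Complex.I))]
  by_cases h : m = τ k
  · right
    simp [stdVec, h, Complex.norm_exp_ofReal_mul_I]
  · left
    simp [stdVec, h]

/-- If `t⁻¹ f(t)` converges as `t → 0` along a punctured set and `f` takes only values that
vanish or have modulus one, then the limit is zero. -/
lemma tendsto_inv_smul_eq_zero_of_eq_zero_or_norm_eq_one {s : Set ℝ}
    [(nhdsWithin (0 : ℝ) (s \ {0})).NeBot] {f : ℝ → ℂ} {L : ℂ}
    (hf : ∀ t ∈ s, f t = 0 ∨ ‖f t‖ = 1)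
    (hL : Filter.Tendsto (fun t : ℝ => t⁻¹ • f t) (nhdsWithin 0 (s \ {0})) (nhds L)) :
    L = 0 := by
  have hmem : ∀ᶠ t in nhdsWithin (0 : ℝ) (s \ {0}), t ∈ s \ {0} := self_mem_nhdsWithin
  have hid : Filter.Tendsto (fun t : ℝ => t) (nhdsWithin 0 (s \ {0})) (nhds 0) :=
    tendsto_nhdsWithin_of_tendsto_nhds Filter.tendsto_id
  have hnorm := (hid.smul hL).norm
  rw [zero_smul, norm_zero] at hnorm
  refine tendsto_nhds_unique hL (tendsto_const_nhds.congr' ?_)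
  filter_upwards [hmem, hnorm.eventually_lt_const one_pos] with t ht hlt
  rw [smul_inv_smul₀ ht.2] at hlt
  rcases hf t ht.1 with h | h
  · rw [h, smul_zero]
  · exact absurd h hlt.ne

/-- If `γ : (−ε, ε) → 𝒢_{O₀}` is a curve with
`γ(0) = U = ∑_n e^{iθ_n}|e_{σ(n)}⟩⟨e_n|`, and `Q` is such that
`(γ(t)h − Uh)/t → Qh` for every `h`, then `Q = ∑_n α_n |e_{σ(n)}⟩⟨e_n|` for some
complex numbers `α_n`, with the same permutation `σ`. In particular every tangent
vector of `𝒢_{O₀}` at the identity has the form `∑_n α_n |e_n⟩⟨e_n|`. -/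
theorem tangent_vector_of_structure_group (d : ℕ) (hd : 1 ≤ d)
    (σ : Equiv.Perm (Fin d)) (θ : Fin d → ℝ) (ε : ℝ) (hε : 0 < ε)
    (γ : ℝ → Op d)
    (hγ : ∀ t ∈ Set.Ioo (-ε) ε, memG (γ t))
    (hγ0 : γ 0 = ∑ n, Complex.exp (θ n * Complex.I) • rankOne (stdVec d (σ n)) (stdVec d n))
    (Q : Op d)
    (hQ : ∀ h : E d, Filter.Tendsto (fun t : ℝ => t⁻¹ • (γ t h - γ 0 h))
      (nhdsWithin 0 (Set.Ioo (-ε) ε \ {0})) (nhds (Q h))) :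
    ∃ α : Fin d → ℂ, Q = ∑ n, α n • rankOne (stdVec d (σ n)) (stdVec d n) := by
  have : (nhdsWithin (0 : ℝ) (Set.Ioo (-ε) ε \ {0})).NeBot := by
    have h : Set.Ioo (-ε) ε ∈ nhds (0 : ℝ) := Ioo_mem_nhds (neg_lt_zero.2 hε) hε
    rw [Set.sdiff_eq, Set.inter_comm, nhdsWithin_inter_of_mem' (mem_nhdsWithin_of_mem_nhds h)]
    infer_instance
  have hentry : ∀ n m : Fin d, m ≠ σ n → Q (stdVec d n) m = 0 := by
    intro n m hm
    have h0 : γ 0 (stdVec d n) m = 0 := by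
      rw [hγ0, sum_smul_rankOne_stdVec_apply σ (fun n => Complex.exp (θ n * Complex.I))]
      simp [stdVec, hm]
    refine tendsto_inv_smul_eq_zero_of_eq_zero_or_norm_eq_one
      (f := fun t => γ t (stdVec d n) m)
      (fun t ht => (hγ t ht).entry_eq_zero_or_norm_eq_one n m) ?_
    have h := ((EuclideanSpace.proj (𝕜 := ℂ) m).continuous.tendsto _).comp (hQ (stdVec d n))
    refine h.congr fun t => ?_
    simp [h0]
  refine ⟨fun n => Q (stdVec d n) (σ n), ?_⟩
  refine ContinuousLinearMap.coe_injective
    ((EuclideanSpace.basisFun (Fin d) ℂ).toBasis.ext fun k => ?_)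
  simp only [OrthonormalBasis.coe_toBasis, EuclideanSpace.basisFun_apply,
    ContinuousLinearMap.coe_coe]
  change Q (stdVec d k) = (∑ n, _ • rankOne (stdVec d (σ n)) (stdVec d n)) (stdVec d k)
  rw [sum_smul_rankOne_stdVec_apply σ (fun n => Q (stdVec d n) (σ n))]
  ext m
  by_cases hm : m = σ k
  · simp [stdVec, hm]
  · rw [hentry k m hm]
    simp [stdVec, hm]
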